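/- If u₁ and u₂ are classical solutions of the boundary reaction problem such that, for i = 1, 2, |u_i| < 1 on ℝ × [0,∞), ∂_t u_i(t,0) > 0 for every t ∈ ℝ, u_i(t,0) → ±1 as t → ±∞, and u₁(0,0) = u₂(0,0) = 0, then u₁ = u₂ on ℝ × [0,∞). -/

import Mathlib

open Real Filter MeasureTheory Set Topology

noncomputable def pt (u : ℝ → ℝ → ℝ) (t y : ℝ) : ℝ := deriv (fun s => u s y) t
noncomputable def py (u : ℝ → ℝ → ℝ) (t y : ℝ) : ℝ := deriv (fun z => u t z) y
noncomputable def ptt (u : ℝ → ℝ → ℝ) (t y : ℝ) : ℝ := deriv (fun s => pt u s y) t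
noncomputable def pyy (u : ℝ → ℝ → ℝ) (t y : ℝ) : ℝ := deriv (fun z => py u t z) y
noncomputable def pty (u : ℝ → ℝ → ℝ) (t y : ℝ) : ℝ := deriv (fun z => pt u t z) y

/-- The degenerate elliptic operator `H_a u = u_yy + (a/y) u_y + u_tt + (n-1) tanh t · u_t`. -/
noncomputable def Ha (n : ℕ) (a : ℝ) (u : ℝ → ℝ → ℝ) (t y : ℝ) : ℝ :=
  pyy u t y + (a / y) * py u t y + ptt u t y + ((n : ℝ) - 1) * Real.tanh t * pt u t y

/-- A classical solution of the boundary reaction problem: a bounded continuous function on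
`ℝ × [0,∞)`, `C²` on `ℝ × (0,∞)`, with `H_a u = 0` there, `∂_t u` extending continuously to
`ℝ × [0,∞)`, and for every `t` the limit `lim_{y→0⁺} y^a ∂_y u(t,y)` exists and equals
`-f(u(t,0)) = F'(u(t,0))`, where `f = -F'`. -/
structure BRSolution (n : ℕ) (a : ℝ) (F : ℝ → ℝ) (u : ℝ → ℝ → ℝ) : Prop where
  bounded : ∃ M : ℝ, ∀ t y : ℝ, 0 ≤ y → |u t y| ≤ M
  cont : ContinuousOn (fun p : ℝ × ℝ => u p.1 p.2) {p : ℝ × ℝ | 0 ≤ p.2}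
  smooth : ContDiffOn ℝ 2 (fun p : ℝ × ℝ => u p.1 p.2) {p : ℝ × ℝ | 0 < p.2}
  eqn : ∀ t y : ℝ, 0 < y → Ha n a u t y = 0
  pt_cont : ContinuousOn (fun p : ℝ × ℝ => pt u p.1 p.2) {p : ℝ × ℝ | 0 ≤ p.2}
  bc : ∀ t : ℝ, Tendsto (fun y : ℝ => y ^ a * py u t y) (𝓝[>] (0:ℝ))
        (𝓝 (deriv F (u t 0)))

/-- `F` is a smooth double-well potential: `F(±1) = 0`, `F > 0` on `(-1,1)`,
`F'(±1) = 0`, `F''(±1) > 0`. -/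
def DoubleWell (F : ℝ → ℝ) : Prop :=
  ContDiff ℝ (⊤ : ℕ∞) F ∧ F (-1) = 0 ∧ F 1 = 0 ∧ (∀ s ∈ Set.Ioo (-1:ℝ) 1, 0 < F s) ∧
    deriv F (-1) = 0 ∧ deriv F 1 = 0 ∧
    0 < iteratedDeriv 2 F (-1) ∧ 0 < iteratedDeriv 2 F 1

theorem hasDerivAt_tanh_real (t : ℝ) : HasDerivAt Real.tanh (1 - Real.tanh t ^ 2) t := by
  have hc : Real.cosh t ≠ 0 := (Real.cosh_pos t).ne'
  have h := (Real.hasDerivAt_sinh t).div (Real.hasDerivAt_cosh t) hc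
  have e : Real.tanh = fun t => Real.sinh t / Real.cosh t :=
    funext Real.tanh_eq_sinh_div_cosh
  rw [e]
  refine h.congr_deriv ?_
  field_simp

theorem strictMono_tanh_real : StrictMono Real.tanh := by
  refine strictMono_of_deriv_pos fun t => ?_
  rw [(hasDerivAt_tanh_real t).deriv, Real.tanh_eq_sinh_div_cosh, div_pow, sub_pos,
    div_lt_one (by have := Real.cosh_pos t; positivity)]
  nlinarith [Real.cosh_sq t]

theorem hasDerivAt_log_cosh (t : ℝ) :
    HasDerivAt (fun s => Real.log (Real.cosh s)) (Real.tanh t) t := by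
  rw [Real.tanh_eq_sinh_div_cosh]
  exact (Real.hasDerivAt_cosh t).log (Real.cosh_pos t).ne'

theorem abs_sub_one_le_log_cosh (t : ℝ) : |t| - 1 ≤ Real.log (Real.cosh t) := by
  have h2 : Real.exp 1 ≥ 2 := by linarith [Real.add_one_le_exp (1 : ℝ)]
  rw [Real.le_log_iff_exp_le (Real.cosh_pos t), Real.exp_sub, ← Real.cosh_abs, Real.cosh_eq,
    div_le_div_iff₀ (by positivity) (by positivity)]
  nlinarith [Real.exp_pos |t|, Real.exp_pos (-|t|)]

theorem log_cosh_nonneg (t : ℝ) : 0 ≤ Real.log (Real.cosh t) :=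
  Real.log_nonneg (Real.one_le_cosh t)

/-- First and second order necessary conditions at a local maximum. -/
theorem IsLocalMax.deriv_zero_and_second_nonpos {g g' : ℝ → ℝ} {x g'' : ℝ}
    (hmax : IsLocalMax g x) (h1 : ∀ᶠ z in 𝓝 x, HasDerivAt g (g' z) z)
    (h2 : HasDerivAt g' g'' x) : g' x = 0 ∧ g'' ≤ 0 := by
  have hd : deriv g =ᶠ[𝓝 x] g' := h1.mono fun z hz => hz.deriv
  have hz : g' x = 0 := hmax.hasDerivAt_eq_zero h1.self_of_nhds
  refine ⟨hz, ?_⟩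
  by_contra! hpos
  have hdd : deriv (deriv g) x = g'' := by rw [hd.deriv_eq, h2.deriv]
  have hmin : IsLocalMin g x :=
    isLocalMin_of_deriv_deriv_pos (by rw [hdd]; exact hpos)
      (by rw [hd.self_of_nhds, hz]) h1.self_of_nhds.continuousAt
  have hconst : g =ᶠ[𝓝 x] fun _ => g x := by
    filter_upwards [hmin, hmax] with z hz1 hz2 using le_antisymm hz2 hz1
  have : deriv g =ᶠ[𝓝 x] fun _ => 0 := by
    simpa using hconst.deriv
  rw [this.deriv_eq] at hdd
  simp at hdd
  linarith

theorem IsLocalMin.deriv_zero_and_second_nonneg {g g' : ℝ → ℝ} {x g'' : ℝ}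
    (hmin : IsLocalMin g x) (h1 : ∀ᶠ z in 𝓝 x, HasDerivAt g (g' z) z)
    (h2 : HasDerivAt g' g'' x) : g' x = 0 ∧ 0 ≤ g'' := by
  have := hmin.neg.deriv_zero_and_second_nonpos (g' := fun z => -g' z)
    (h1.mono fun z hz => hz.neg) h2.neg
  constructor <;> linarith [this.1, this.2]

theorem ContDiffAt.differentiableAt_deriv_of_two {g : ℝ → ℝ} {x : ℝ} (h : ContDiffAt ℝ 2 g x) :
    DifferentiableAt ℝ (deriv g) x := by
  have h1 : ContDiffAt ℝ 1 (fderiv ℝ g) x := h.fderiv_right (by norm_num)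
  have h2 : deriv g = fun z => fderiv ℝ g z 1 := funext fun z => fderiv_apply_one_eq_deriv.symm
  rw [h2]
  exact (h1.differentiableAt (by norm_num)).clm_apply (differentiableAt_const _)

/-- If `w` stays below its value at `0`, then the weighted normal derivative `y ^ a * w'` cannot
have a positive limit at `0`. -/
theorem weighted_deriv_limit_nonpos {a l : ℝ} {w w' : ℝ → ℝ}
    (hc : ContinuousOn w (Ici 0)) (hd : ∀ y, 0 < y → HasDerivAt w (w' y) y)
    (hle : ∀ y, 0 ≤ y → w y ≤ w 0)
    (hl : Tendsto (fun y => y ^ a * w' y) (𝓝[>] (0 : ℝ)) (𝓝 l)) : l ≤ 0 := by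
  by_contra! hpos
  obtain ⟨η, hη, h⟩ := mem_nhdsGT_iff_exists_Ioc_subset.1 (hl.eventually (lt_mem_nhds hpos))
  have hη : 0 < η := hη
  have hm : StrictMonoOn w (Icc 0 η) := by
    refine strictMonoOn_of_deriv_pos (convex_Icc 0 η) (hc.mono Icc_subset_Ici_self) ?_
    intro y hy
    rw [interior_Icc] at hy
    rw [(hd y hy.1).deriv]
    have h3 : 0 < y ^ a * w' y := h ⟨hy.1, hy.2.le⟩
    exact pos_of_mul_pos_right h3 (Real.rpow_nonneg hy.1.le a)
  have := hm (left_mem_Icc.2 hη.le) (right_mem_Icc.2 hη.le) hη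
  linarith [hle η hη.le]

/-- If `w 0 = 0` and `w y ≥ c (y ^ (1 - a) - K y ^ 2)` near `0` with `c > 0`, then `y ^ a * w'`
does not tend to `0`. -/
theorem weighted_deriv_not_tendsto_zero {a c K r : ℝ} (ha : a ∈ Ioo (-1 : ℝ) 1) (hcpos : 0 < c)
    (hr : 0 < r) {w w' : ℝ → ℝ}
    (hc : ContinuousOn w (Ici 0)) (hd : ∀ y, 0 < y → HasDerivAt w (w' y) y) (h0 : w 0 = 0)
    (hge : ∀ y ∈ Icc 0 r, c * (y ^ (1 - a) - K * y ^ 2) ≤ w y) :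
    ¬ Tendsto (fun y => y ^ a * w' y) (𝓝[>] (0 : ℝ)) (𝓝 0) := by
  intro hl
  have ha1 : 0 < 1 - a := by linarith [ha.2]
  have ha2 : 0 < 1 + a := by linarith [ha.1]
  obtain ⟨η, hη, h⟩ := mem_nhdsGT_iff_exists_Ioc_subset.1
    (hl.eventually (gt_mem_nhds (show 0 < c / 2 * (1 - a) by positivity)))
  have hη : 0 < η := hη
  have hpow : Continuous fun y : ℝ => y ^ (1 - a) := Real.continuous_rpow_const ha1.le
  have hder : ∀ y, 0 < y → HasDerivAt (fun y => w y - c / 2 * y ^ (1 - a))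
      (w' y - c / 2 * ((1 - a) * y ^ (1 - a - 1))) y := fun y hy =>
    (hd y hy).sub ((Real.hasDerivAt_rpow_const (Or.inl hy.ne')).const_mul _)
  have hm : AntitoneOn (fun y => w y - c / 2 * y ^ (1 - a)) (Icc 0 η) := by
    refine antitoneOn_of_deriv_nonpos (convex_Icc 0 η) ?_ ?_ ?_
    · exact (hc.mono Icc_subset_Ici_self).sub (hpow.const_mul _).continuousOn
    · intro y hy
      rw [interior_Icc] at hy
      exact (hder y hy.1).differentiableAt.differentiableWithinAt
    · intro y hy
      rw [interior_Icc] at hy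
      rw [(hder y hy.1).deriv]
      have h3 : y ^ a * w' y < c / 2 * (1 - a) := h ⟨hy.1, hy.2.le⟩
      have h4 : y ^ a * y ^ (1 - a - 1) = 1 := by
        rw [← Real.rpow_add hy.1]; norm_num
      have h5 : 0 < y ^ a := Real.rpow_pos_of_pos hy.1 a
      by_contra! h6
      have h7 := mul_pos h5 h6
      have h8 : y ^ a * (w' y - c / 2 * ((1 - a) * y ^ (1 - a - 1))) =
          y ^ a * w' y - c / 2 * (1 - a) * (y ^ a * y ^ (1 - a - 1)) := by ring
      rw [h8, h4] at h7
      linarith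
  have hub : ∀ y ∈ Ioc 0 (min η r), 1 ≤ 2 * K * y ^ (1 + a) := by
    intro y hy
    have hy1 : y ≤ η := hy.2.trans (min_le_left _ _)
    have hy2 : y ≤ r := hy.2.trans (min_le_right _ _)
    have h1 := hm (left_mem_Icc.2 hη.le) ⟨hy.1.le, hy1⟩ hy.1.le
    simp only [h0, Real.zero_rpow ha1.ne', mul_zero, sub_zero] at h1
    have h2 := hge y ⟨hy.1.le, hy2⟩
    have h5 : 0 < y ^ (1 - a) := Real.rpow_pos_of_pos hy.1 _
    have h6 : y ^ 2 = y ^ (1 - a) * y ^ (1 + a) := by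
      rw [← Real.rpow_add hy.1, ← Real.rpow_natCast]; norm_num
    have h7 : c * (y ^ (1 - a) * (1 - 2 * K * y ^ (1 + a))) ≤ 0 := by
      rw [h6] at h2; linarith
    have h8 := nonpos_of_mul_nonpos_right h7 hcpos
    linarith [nonpos_of_mul_nonpos_right h8 h5]
  have hlim : Tendsto (fun y : ℝ => 2 * K * y ^ (1 + a)) (𝓝[>] 0) (𝓝 0) := by
    have : Continuous fun y : ℝ => 2 * K * y ^ (1 + a) :=
      (Real.continuous_rpow_const ha2.le).const_mul _
    have h := (this.tendsto 0).mono_left (nhdsWithin_le_nhds (s := Ioi 0))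
    simpa [Real.zero_rpow ha2.ne'] using h
  have hev : ∀ᶠ y in 𝓝[>] (0 : ℝ), 1 ≤ 2 * K * y ^ (1 + a) :=
    mem_of_superset (Ioc_mem_nhdsGT (lt_min hη hr)) hub
  have := le_of_tendsto_of_tendsto tendsto_const_nhds hlim hev
  linarith

namespace BRSolution

variable {n : ℕ} {a : ℝ} {F : ℝ → ℝ} {u : ℝ → ℝ → ℝ}

theorem hasDerivAt_pt (hu : BRSolution n a F u) (t : ℝ) {y : ℝ} (hy : 0 < y) :
    HasDerivAt (fun s => u s y) (pt u t y) t := by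
  have ho : {p : ℝ × ℝ | 0 < p.2} ∈ 𝓝 (t, y) :=
    (isOpen_lt continuous_const continuous_snd).mem_nhds hy
  have h1 : DifferentiableAt ℝ (fun p : ℝ × ℝ => u p.1 p.2) (t, y) :=
    (hu.smooth.contDiffAt ho).differentiableAt (by norm_num)
  have h2 : DifferentiableAt ℝ (fun s : ℝ => (s, y)) t := by fun_prop
  exact (DifferentiableAt.comp t (f := fun s : ℝ => (s, y)) h1 h2).hasDerivAt

theorem hasDerivAt_py (hu : BRSolution n a F u) (t : ℝ) {y : ℝ} (hy : 0 < y) :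
    HasDerivAt (fun z => u t z) (py u t y) y := by
  have ho : {p : ℝ × ℝ | 0 < p.2} ∈ 𝓝 (t, y) :=
    (isOpen_lt continuous_const continuous_snd).mem_nhds hy
  have h1 : DifferentiableAt ℝ (fun p : ℝ × ℝ => u p.1 p.2) (t, y) :=
    (hu.smooth.contDiffAt ho).differentiableAt (by norm_num)
  have h2 : DifferentiableAt ℝ (fun z : ℝ => (t, z)) y := by fun_prop
  exact (DifferentiableAt.comp y (f := fun z : ℝ => (t, z)) h1 h2).hasDerivAt

theorem hasDerivAt_ptt (hu : BRSolution n a F u) (t : ℝ) {y : ℝ} (hy : 0 < y) :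
    HasDerivAt (fun s => pt u s y) (ptt u t y) t := by
  have ho : {p : ℝ × ℝ | 0 < p.2} ∈ 𝓝 (t, y) :=
    (isOpen_lt continuous_const continuous_snd).mem_nhds hy
  have h1 : ContDiffAt ℝ 2 (fun s => u s y) t :=
    ContDiffAt.comp (f := fun s : ℝ => (s, y)) t (hu.smooth.contDiffAt ho) (by fun_prop)
  exact h1.differentiableAt_deriv_of_two.hasDerivAt

theorem hasDerivAt_pyy (hu : BRSolution n a F u) (t : ℝ) {y : ℝ} (hy : 0 < y) :
    HasDerivAt (fun z => py u t z) (pyy u t y) y := by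
  have ho : {p : ℝ × ℝ | 0 < p.2} ∈ 𝓝 (t, y) :=
    (isOpen_lt continuous_const continuous_snd).mem_nhds hy
  have h1 : ContDiffAt ℝ 2 (fun z => u t z) y :=
    ContDiffAt.comp (f := fun z : ℝ => (t, z)) y (hu.smooth.contDiffAt ho) (by fun_prop)
  exact h1.differentiableAt_deriv_of_two.hasDerivAt

theorem continuous_trace (hu : BRSolution n a F u) : Continuous fun t => u t 0 :=
  hu.cont.comp_continuous (f := fun t : ℝ => (t, (0 : ℝ))) (by fun_prop) fun _ => le_refl (0 : ℝ)

theorem continuousOn_vertical (hu : BRSolution n a F u) (t : ℝ) :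
    ContinuousOn (fun y => u t y) (Ici 0) :=
  hu.cont.comp (f := fun y : ℝ => (t, y)) (by fun_prop) fun _ hy => hy

end BRSolution

section Comparison

variable {n : ℕ} {a : ℝ} {F : ℝ → ℝ} {u v : ℝ → ℝ → ℝ}

set_option maxHeartbeats 800000 in
/-- The barrier estimate behind the comparison principle in doubled variables. -/
theorem comparison_with_barrier (hn : 2 ≤ n) (ha : a ∈ Ioo (-1 : ℝ) 1)
    (hu : BRSolution n a F u) (hv : BRSolution n a F v)
    (hbu : ∀ t y : ℝ, 0 ≤ y → |u t y| < 1) (hbv : ∀ t y : ℝ, 0 ≤ y → |v t y| < 1)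
    {s m : ℝ} (hs : 0 ≤ s) (hm : 0 ≤ m)
    (htr : ∀ t₁ t₂ : ℝ, t₁ + s ≤ t₂ → u t₁ 0 - v t₂ 0 ≤ m)
    {b ε δ Y : ℝ} (hb : b = (1 - a) / 2) (hε : 0 < ε) (hδ : 0 < δ) (hY : 0 < Y)
    (hεY : 2 ≤ ε * Y ^ b) (hδε : 2 * n * δ < ε * b ^ 2 * Y ^ (b - 2))
    {t₁ t₂ y : ℝ} (ht : t₁ + s ≤ t₂) (hy : 0 ≤ y) :
    u t₁ y - v t₂ y ≤ m + ε * y ^ b + δ * Real.log (Real.cosh t₁) +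
      δ * Real.log (Real.cosh t₂) := by
  have hbpos : 0 < b := by rw [hb]; linarith [ha.2]
  have hb2 : b - 2 ≤ 0 := by rw [hb]; linarith [ha.1]
  set Φ : ℝ × ℝ × ℝ → ℝ := fun p => u p.1 p.2.2 - v p.2.1 p.2.2 -
    (m + ε * p.2.2 ^ b + δ * Real.log (Real.cosh p.1) + δ * Real.log (Real.cosh p.2.1)) with hΦ
  suffices h : Φ (t₁, t₂, y) ≤ 0 by simp only [hΦ] at h; linarith
  by_contra! hpos
  have hlt2 : ∀ p : ℝ × ℝ × ℝ, 0 ≤ p.2.2 → u p.1 p.2.2 - v p.2.1 p.2.2 < 2 := fun p hp => by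
    linarith [(abs_lt.1 (hbu p.1 _ hp)).2, (abs_lt.1 (hbv p.2.1 _ hp)).1]
  have hYle : ∀ p : ℝ × ℝ × ℝ, 0 ≤ p.2.2 → 0 < Φ p → p.2.2 < Y := by
    intro p hp h
    by_contra! hle
    have h1 : Y ^ b ≤ p.2.2 ^ b := Real.rpow_le_rpow hY.le hle hbpos.le
    have h2 := mul_le_mul_of_nonneg_left h1 hε.le
    have h3 := mul_nonneg hδ.le (log_cosh_nonneg p.1)
    have h4 := mul_nonneg hδ.le (log_cosh_nonneg p.2.1)
    simp only [hΦ] at h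
    linarith [hlt2 p hp]
  set T : ℝ := 2 / δ + 1 with hT
  have hTle : ∀ p : ℝ × ℝ × ℝ, 0 ≤ p.2.2 → 0 < Φ p → |p.1| ≤ T ∧ |p.2.1| ≤ T := by
    intro p hp h
    have h1 := mul_nonneg hε.le (Real.rpow_nonneg hp b)
    have h3 := mul_nonneg hδ.le (log_cosh_nonneg p.1)
    have h4 := mul_nonneg hδ.le (log_cosh_nonneg p.2.1)
    have key : ∀ t : ℝ, δ * Real.log (Real.cosh t) < 2 → |t| ≤ T := by
      intro t h5
      have h6 : Real.log (Real.cosh t) < 2 / δ := by rwa [lt_div_iff₀ hδ, mul_comm]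
      linarith [abs_sub_one_le_log_cosh t]
    simp only [hΦ] at h
    exact ⟨key _ (by linarith [hlt2 p hp]), key _ (by linarith [hlt2 p hp])⟩
  set S : Set (ℝ × ℝ × ℝ) := (Icc (-T) T ×ˢ Icc (-T) T ×ˢ Icc 0 Y) ∩ {p | p.1 + s ≤ p.2.1}
    with hS
  have hSc : IsCompact S :=
    (isCompact_Icc.prod (isCompact_Icc.prod isCompact_Icc)).inter_right
      (isClosed_le (by fun_prop) (by fun_prop))
  have hmem : ∀ p : ℝ × ℝ × ℝ, 0 ≤ p.2.2 → p.1 + s ≤ p.2.1 → 0 < Φ p → p ∈ S :=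
    fun p hp hps h => ⟨⟨abs_le.1 (hTle p hp h).1, abs_le.1 (hTle p hp h).2, hp, (hYle p hp h).le⟩,
      hps⟩
  have hcont : ContinuousOn Φ S := by
    have h1 : ContinuousOn (fun p : ℝ × ℝ × ℝ => u p.1 p.2.2) S :=
      hu.cont.comp (f := fun p : ℝ × ℝ × ℝ => (p.1, p.2.2)) (by fun_prop)
        fun p hp => hp.1.2.2.1
    have h2 : ContinuousOn (fun p : ℝ × ℝ × ℝ => v p.2.1 p.2.2) S :=
      hv.cont.comp (f := fun p : ℝ × ℝ × ℝ => (p.2.1, p.2.2)) (by fun_prop)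
        fun p hp => hp.1.2.2.1
    have h3 : Continuous fun p : ℝ × ℝ × ℝ => p.2.2 ^ b :=
      (Real.continuous_rpow_const hbpos.le).comp (by fun_prop)
    have h4 : Continuous fun t : ℝ => Real.log (Real.cosh t) :=
      Real.continuous_cosh.log fun t => (Real.cosh_pos t).ne'
    have h5 : Continuous fun p : ℝ × ℝ × ℝ => m + ε * p.2.2 ^ b +
        δ * Real.log (Real.cosh p.1) + δ * Real.log (Real.cosh p.2.1) :=
      ((continuous_const.add (h3.const_mul _)).add ((h4.comp continuous_fst).const_mul _)).add
        ((h4.comp (continuous_fst.comp continuous_snd)).const_mul _)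
    exact (h1.sub h2).sub h5.continuousOn
  obtain ⟨⟨x₁, x₂, z⟩, hpS, hmaxS⟩ := hSc.exists_isMaxOn ⟨_, hmem (t₁, t₂, y) hy ht hpos⟩ hcont
  have hP : 0 < Φ (x₁, x₂, z) := hpos.trans_le (hmaxS (hmem (t₁, t₂, y) hy ht hpos))
  have hz0 : 0 ≤ z := hpS.1.2.2.1
  have hx : x₁ + s ≤ x₂ := hpS.2
  have hmax : ∀ p : ℝ × ℝ × ℝ, 0 ≤ p.2.2 → p.1 + s ≤ p.2.1 → Φ p ≤ Φ (x₁, x₂, z) := by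
    intro p hp hps
    rcases le_or_gt (Φ p) 0 with h | h
    · exact h.trans hP.le
    · exact hmaxS (hmem p hp hps h)
  have hz : 0 < z := by
    rcases hz0.lt_or_eq with h | h
    · exact h
    · exfalso
      have h3 := mul_nonneg hδ.le (log_cosh_nonneg x₁)
      have h4 := mul_nonneg hδ.le (log_cosh_nonneg x₂)
      have h5 := htr x₁ x₂ hx
      simp only [hΦ, ← h, Real.zero_rpow hbpos.ne'] at hP
      linarith
  have hzY : z < Y := hYle _ hz0 hP
  have hg := IsLocalMax.deriv_zero_and_second_nonpos (x := 0)
    (g := fun τ => Φ (x₁ + τ, x₂ + τ, z))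
    (g' := fun τ => pt u (x₁ + τ) z - pt v (x₂ + τ) z -
      (δ * Real.tanh (x₁ + τ) + δ * Real.tanh (x₂ + τ)))
    (g'' := ptt u x₁ z - ptt v x₂ z -
      (δ * (1 - Real.tanh x₁ ^ 2) + δ * (1 - Real.tanh x₂ ^ 2)))
    (Eventually.of_forall fun τ => by
      simpa using hmax (x₁ + τ, x₂ + τ, z) hz0 (by simp only; linarith))
    (Eventually.of_forall fun τ => by
      have h1 := (hu.hasDerivAt_pt (x₁ + τ) hz).comp_const_add x₁ τ
      have h2 := (hv.hasDerivAt_pt (x₂ + τ) hz).comp_const_add x₂ τ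
      have h3 := ((hasDerivAt_log_cosh (x₁ + τ)).comp_const_add x₁ τ).const_mul δ
      have h4 := ((hasDerivAt_log_cosh (x₂ + τ)).comp_const_add x₂ τ).const_mul δ
      exact (h1.sub h2).sub ((h3.const_add (m + ε * z ^ b)).add h4))
    (by
      have h1 := HasDerivAt.comp_const_add x₁ (0 : ℝ) (f := fun t => pt u t z)
        (by simpa using hu.hasDerivAt_ptt x₁ hz)
      have h2 := HasDerivAt.comp_const_add x₂ (0 : ℝ) (f := fun t => pt v t z)
        (by simpa using hv.hasDerivAt_ptt x₂ hz)
      have h3 := (HasDerivAt.comp_const_add x₁ (0 : ℝ) (f := Real.tanh)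
        (by simpa using hasDerivAt_tanh_real x₁)).const_mul δ
      have h4 := (HasDerivAt.comp_const_add x₂ (0 : ℝ) (f := Real.tanh)
        (by simpa using hasDerivAt_tanh_real x₂)).const_mul δ
      exact (h1.sub h2).sub (h3.add h4))
  have hk := IsLocalMax.deriv_zero_and_second_nonpos (x := z)
    (g := fun η => Φ (x₁, x₂, η))
    (g' := fun η => py u x₁ η - py v x₂ η - ε * (b * η ^ (b - 1)))
    (g'' := pyy u x₁ z - pyy v x₂ z - ε * (b * ((b - 1) * z ^ (b - 1 - 1))))
    (by
      filter_upwards [lt_mem_nhds hz] with η hη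
      exact hmax (x₁, x₂, η) hη.le hx)
    (by
      filter_upwards [lt_mem_nhds hz] with η hη
      have h1 := hu.hasDerivAt_py x₁ hη
      have h2 := hv.hasDerivAt_py x₂ hη
      have h3 := (Real.hasDerivAt_rpow_const (p := b) (Or.inl hη.ne')).const_mul ε
      exact (h1.sub h2).sub (((h3.const_add m).add_const
        (δ * Real.log (Real.cosh x₁))).add_const (δ * Real.log (Real.cosh x₂))))
    (by
      have h1 := hu.hasDerivAt_pyy x₁ hz
      have h2 := hv.hasDerivAt_pyy x₂ hz
      have h3 := ((Real.hasDerivAt_rpow_const (p := b - 1) (Or.inl hz.ne')).const_mul b).const_mul ε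
      exact (h1.sub h2).sub h3)
  have hl : δ * Real.tanh x₁ ≤ pt u x₁ z := by
    by_contra! hlt
    have h1 := (hu.hasDerivAt_pt x₁ hz).sub ((hasDerivAt_log_cosh x₁).const_mul δ)
    have h2 := (hasDerivAt_iff_tendsto_slope.1 h1).eventually (gt_mem_nhds (sub_neg.2 hlt))
    have h3 : ∀ᶠ τ in 𝓝[<] x₁, slope ((fun s => u s z) - fun s => δ * Real.log (Real.cosh s)) x₁ τ
        < 0 := h2.filter_mono (nhdsWithin_mono _ fun τ (hτ : τ < x₁) => hτ.ne)
    obtain ⟨τ, hτ, hτx⟩ := (h3.and self_mem_nhdsWithin).exists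
    have hτx : τ < x₁ := hτx
    have h4 := hmax (τ, x₂, z) hz0 (by simp only; linarith)
    rw [slope_def_field, div_neg_iff] at hτ
    simp only [hΦ] at h4
    simp only [Pi.sub_apply] at hτ
    rcases hτ with h | h <;> linarith [h.1, h.2]
  obtain ⟨hg1, hg2⟩ := hg
  obtain ⟨hk1, hk2⟩ := hk
  simp only [add_zero] at hg1
  have eu := hu.eqn x₁ z hz
  have ev := hv.eqn x₂ z hz
  simp only [Ha] at eu ev
  have hb1 : 1 + (b - 2) ≠ 0 := by
    have h1 := ha.1
    rw [hb]
    exact ne_of_lt (by linarith)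
  have hpw1 : z ^ (b - 1) = z * z ^ (b - 2) := by
    rw [← Real.rpow_one_add' hz.le hb1]
    congr 1; ring
  have hpw2 : z ^ (b - 1 - 1) = z ^ (b - 2) := by congr 1; ring
  have hYz : Y ^ (b - 2) ≤ z ^ (b - 2) := Real.rpow_le_rpow_of_nonpos hz hzY.le hb2
  rw [hpw2] at hk2
  have hk3 : a / z * py u x₁ z - a / z * py v x₂ z = a * ε * b * z ^ (b - 2) := by
    rw [← mul_sub, show py u x₁ z - py v x₂ z = ε * (b * (z * z ^ (b - 2))) by
      rw [← hpw1]; linarith]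
    field_simp
  have hab : a = 1 - 2 * b := by rw [hb]; ring
  have hN : 0 ≤ (n : ℝ) - 1 := by
    have : (2 : ℝ) ≤ n := by exact_mod_cast hn
    linarith
  have htanh : Real.tanh x₁ ≤ Real.tanh x₂ := strictMono_tanh_real.monotone (by linarith)
  have hT1 := (Real.tanh_sq_lt_one x₁).le
  have hT2 := (Real.tanh_sq_lt_one x₂).le
  have hdrift : Real.tanh x₁ * pt u x₁ z - Real.tanh x₂ * pt v x₂ z ≤ 2 * δ := by
    have e : pt v x₂ z = pt u x₁ z - (δ * Real.tanh x₁ + δ * Real.tanh x₂) := by linarith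
    rw [e]
    linarith [mul_nonneg (sub_nonneg.2 htanh) (sub_nonneg.2 hl),
      mul_nonneg hδ.le (sub_nonneg.2 hT1), mul_nonneg hδ.le (sub_nonneg.2 hT2)]
  have hdrift2 := mul_le_mul_of_nonneg_left hdrift hN
  have hsecond : ptt u x₁ z - ptt v x₂ z ≤ 2 * δ := by
    linarith [mul_nonneg hδ.le (sq_nonneg (Real.tanh x₁)),
      mul_nonneg hδ.le (sq_nonneg (Real.tanh x₂))]
  have hYz2 : ε * b ^ 2 * Y ^ (b - 2) ≤ ε * b ^ 2 * z ^ (b - 2) :=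
    mul_le_mul_of_nonneg_left hYz (by positivity)
  have hsum : ε * (b * ((b - 1) * z ^ (b - 2))) + a * ε * b * z ^ (b - 2) =
      -(ε * b ^ 2 * z ^ (b - 2)) := by rw [hab]; ring
  linarith

/-- Comparison principle: a bound for `u t₁ - v t₂` on the trace, over all `t₂ ≥ t₁ + s`,
propagates to the whole half-plane. -/
theorem comparison (hn : 2 ≤ n) (ha : a ∈ Ioo (-1 : ℝ) 1)
    (hu : BRSolution n a F u) (hv : BRSolution n a F v)
    (hbu : ∀ t y : ℝ, 0 ≤ y → |u t y| < 1) (hbv : ∀ t y : ℝ, 0 ≤ y → |v t y| < 1)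
    {s m : ℝ} (hs : 0 ≤ s) (hm : 0 ≤ m)
    (htr : ∀ t₁ t₂ : ℝ, t₁ + s ≤ t₂ → u t₁ 0 - v t₂ 0 ≤ m)
    {t₁ t₂ y : ℝ} (ht : t₁ + s ≤ t₂) (hy : 0 ≤ y) : u t₁ y - v t₂ y ≤ m := by
  have hb : 0 < (1 - a) / 2 := by linarith [ha.2]
  have hstep : ∀ ε > 0, u t₁ y - v t₂ y ≤ m + ε * y ^ ((1 - a) / 2) := by
    intro ε hε
    set Y : ℝ := (2 / ε) ^ ((1 - a) / 2)⁻¹ with hY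
    have hYpos : 0 < Y := by positivity
    have hYb : Y ^ ((1 - a) / 2) = 2 / ε := Real.rpow_inv_rpow (by positivity) hb.ne'
    have hlim : Tendsto (fun δ : ℝ => m + ε * y ^ ((1 - a) / 2) + δ * Real.log (Real.cosh t₁) +
        δ * Real.log (Real.cosh t₂)) (𝓝[>] 0) (𝓝 (m + ε * y ^ ((1 - a) / 2))) := by
      have : Continuous fun δ : ℝ => m + ε * y ^ ((1 - a) / 2) + δ * Real.log (Real.cosh t₁) +
        δ * Real.log (Real.cosh t₂) := by fun_prop
      simpa using (this.tendsto 0).mono_left (nhdsWithin_le_nhds (s := Ioi 0))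
    have hsmall : ∀ᶠ δ : ℝ in 𝓝[>] 0,
        2 * n * δ < ε * ((1 - a) / 2) ^ 2 * Y ^ ((1 - a) / 2 - 2) := by
      have hc : Continuous fun δ : ℝ => 2 * n * δ := by fun_prop
      refine ((hc.tendsto 0).mono_left nhdsWithin_le_nhds).eventually (gt_mem_nhds ?_)
      simp only [mul_zero]
      positivity
    refine ge_of_tendsto hlim ?_
    filter_upwards [hsmall, self_mem_nhdsWithin] with δ hδ1 hδ2
    exact comparison_with_barrier hn ha hu hv hbu hbv hs hm htr rfl hε hδ2 hYpos
      (by rw [hYb]; field_simp; rfl) hδ1 ht hy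
  have hlim : Tendsto (fun ε : ℝ => m + ε * y ^ ((1 - a) / 2)) (𝓝[>] 0) (𝓝 m) := by
    have : Continuous fun ε : ℝ => m + ε * y ^ ((1 - a) / 2) := by fun_prop
    simpa using (this.tendsto 0).mono_left (nhdsWithin_le_nhds (s := Ioi 0))
  refine ge_of_tendsto hlim ?_
  filter_upwards [self_mem_nhdsWithin] with ε hε using hstep ε hε

end Comparison

section Sliding

variable {n : ℕ} {a : ℝ} {F : ℝ → ℝ} {u v : ℝ → ℝ → ℝ}

set_option maxHeartbeats 800000 in
/-- A Hopf-type barrier: if `v (· + s)` lies above `u` and the drift defect is at least `κ` on a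
half-square, then `v (· + s) - u` grows at least like `y ^ (1 - a)` above its centre. -/
theorem boundary_growth (hn : 2 ≤ n) (ha : a ∈ Ioo (-1 : ℝ) 1)
    (hu : BRSolution n a F u) (hv : BRSolution n a F v) {s t₀ r κ : ℝ}
    (hr : 0 < r) (hr1 : r ≤ 1) (hκ : 0 < κ)
    (hle : ∀ t y : ℝ, 0 ≤ y → u t y ≤ v (t + s) y)
    (hdef : ∀ t ∈ Icc (t₀ - r) (t₀ + r), ∀ y ∈ Icc 0 r,
      κ < ((n : ℝ) - 1) * (Real.tanh (t + s) - Real.tanh t) * pt v (t + s) y) :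
    ∃ c K : ℝ, 0 < c ∧ ∀ y ∈ Icc 0 r, c * (y ^ (1 - a) - K * y ^ 2) ≤ v (t₀ + s) y - u t₀ y := by
  have hP : 0 < 1 - a := by linarith [ha.2]
  set K : ℝ := r ^ (1 - a) / r ^ 2 with hK
  have hKpos : 0 < K := by positivity
  have hKr : K * r ^ 2 = r ^ (1 - a) := by rw [hK]; field_simp
  set c : ℝ := κ / (K * (6 + 2 * n)) with hc
  have hcpos : 0 < c := by positivity
  have hcK : c * K * (6 + 2 * n) = κ := by rw [hc]; field_simp
  refine ⟨c, K, hcpos, ?_⟩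
  set Ψ : ℝ × ℝ → ℝ := fun p => v (p.1 + s) p.2 - u p.1 p.2 -
    c * (p.2 ^ (1 - a) - K * ((p.1 - t₀) ^ 2 + p.2 ^ 2)) with hΨ
  set R : Set (ℝ × ℝ) := Icc (t₀ - r) (t₀ + r) ×ˢ Icc 0 r with hR
  suffices h : ∀ p ∈ R, 0 ≤ Ψ p by
    intro y hy
    have := h (t₀, y) ⟨⟨by linarith, by linarith⟩, hy⟩
    simp only [hΨ, sub_self] at this
    linarith
  have hcont : ContinuousOn Ψ R := by
    have h1 : ContinuousOn (fun p : ℝ × ℝ => v (p.1 + s) p.2) R :=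
      hv.cont.comp (f := fun p : ℝ × ℝ => (p.1 + s, p.2)) (by fun_prop) fun p hp => hp.2.1
    have h2 : ContinuousOn (fun p : ℝ × ℝ => u p.1 p.2) R := hu.cont.mono fun p hp => hp.2.1
    have h3 : Continuous fun p : ℝ × ℝ => p.2 ^ (1 - a) :=
      (Real.continuous_rpow_const hP.le).comp continuous_snd
    have h4 : Continuous fun p : ℝ × ℝ =>
        c * (p.2 ^ (1 - a) - K * ((p.1 - t₀) ^ 2 + p.2 ^ 2)) := by fun_prop
    exact (h1.sub h2).sub h4.continuousOn
  have hRc : IsCompact R := isCompact_Icc.prod isCompact_Icc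
  by_contra! hneg
  obtain ⟨p, hpR, hp⟩ := hneg
  obtain ⟨⟨t, y⟩, hqR, hmin⟩ := hRc.exists_isMinOn ⟨p, hpR⟩ hcont
  have hq : Ψ (t, y) < 0 := (hmin hpR).trans_lt hp
  have hy0 : 0 ≤ y := hqR.2.1
  have hbneg : 0 < y ^ (1 - a) - K * ((t - t₀) ^ 2 + y ^ 2) := by
    by_contra! hb
    have h1 := mul_nonpos_of_nonneg_of_nonpos hcpos.le hb
    simp only [hΨ] at hq
    linarith [hle t y hy0]
  have hyr : y ^ (1 - a) ≤ K * r ^ 2 := by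
    rw [hKr]; exact Real.rpow_le_rpow hy0 hqR.2.2 hP.le
  have hball : (t - t₀) ^ 2 + y ^ 2 < r ^ 2 :=
    lt_of_mul_lt_mul_left (by linarith) hKpos.le
  have hy : 0 < y := by
    rcases hy0.lt_or_eq with h | h
    · exact h
    · rw [← h, Real.zero_rpow hP.ne'] at hbneg
      linarith [mul_nonneg hKpos.le (add_nonneg (sq_nonneg (t - t₀)) (sq_nonneg (0 : ℝ)))]
  have hyltr : y < r := lt_of_pow_lt_pow_left₀ 2 hr.le (by linarith [sq_nonneg (t - t₀)])
  have htr : |t - t₀| < r := by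
    refine lt_of_pow_lt_pow_left₀ 2 hr.le ?_
    rw [sq_abs]; linarith [sq_nonneg y]
  have htr' := abs_lt.1 htr
  have hg := IsLocalMin.deriv_zero_and_second_nonneg (x := t)
    (g := fun τ => Ψ (τ, y))
    (g' := fun τ => pt v (τ + s) y - pt u τ y - c * (-(K * (2 * (τ - t₀)))))
    (g'' := ptt v (t + s) y - ptt u t y - c * (-(K * (2 * 1))))
    (by
      filter_upwards [Ioo_mem_nhds (show t₀ - r < t by linarith) (show t < t₀ + r by linarith)]
        with τ hτ
      exact hmin (show (τ, y) ∈ R from ⟨⟨hτ.1.le, hτ.2.le⟩, hqR.2⟩))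
    (Eventually.of_forall fun τ => by
      have h1 := (hv.hasDerivAt_pt (τ + s) hy).comp_add_const τ s
      have h2 := hu.hasDerivAt_pt τ hy
      have h3 : HasDerivAt (fun τ : ℝ => (τ - t₀) ^ 2 + y ^ 2) (2 * (τ - t₀)) τ := by
        simpa using (((hasDerivAt_id τ).sub_const t₀).pow 2).add_const (y ^ 2)
      exact (h1.sub h2).sub (((h3.const_mul K).const_sub (y ^ (1 - a))).const_mul c))
    (by
      have h1 := HasDerivAt.comp_add_const t s (f := fun t => pt v t y)
        (hv.hasDerivAt_ptt (t + s) hy)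
      have h2 := hu.hasDerivAt_ptt t hy
      have h3 := (((((hasDerivAt_id t).sub_const t₀).const_mul 2).const_mul K).neg).const_mul c
      exact (h1.sub h2).sub h3)
  have hk := IsLocalMin.deriv_zero_and_second_nonneg (x := y)
    (g := fun η => Ψ (t, η))
    (g' := fun η => py v (t + s) η - py u t η - c * ((1 - a) * η ^ (1 - a - 1) - K * (2 * η)))
    (g'' := pyy v (t + s) y - pyy u t y -
      c * ((1 - a) * ((1 - a - 1) * y ^ (1 - a - 1 - 1)) - K * (2 * 1)))
    (by
      filter_upwards [Ioo_mem_nhds hy hyltr] with η hη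
      exact hmin (show (t, η) ∈ R from ⟨hqR.1, ⟨hη.1.le, hη.2.le⟩⟩))
    (by
      filter_upwards [lt_mem_nhds hy] with η hη
      have h1 := hv.hasDerivAt_py (t + s) hη
      have h2 := hu.hasDerivAt_py t hη
      have h3 := Real.hasDerivAt_rpow_const (p := 1 - a) (Or.inl hη.ne')
      have h4 : HasDerivAt (fun η : ℝ => (t - t₀) ^ 2 + η ^ 2) (2 * η) η := by
        simpa using ((hasDerivAt_id η).pow 2).const_add ((t - t₀) ^ 2)
      exact (h1.sub h2).sub ((h3.sub (h4.const_mul K)).const_mul c))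
    (by
      have h1 := hv.hasDerivAt_pyy (t + s) hy
      have h2 := hu.hasDerivAt_pyy t hy
      have h3 := (Real.hasDerivAt_rpow_const (p := 1 - a - 1) (Or.inl hy.ne')).const_mul (1 - a)
      have h4 := ((hasDerivAt_id y).const_mul 2).const_mul K
      exact (h1.sub h2).sub ((h3.sub h4).const_mul c))
  obtain ⟨hg1, hg2⟩ := hg
  obtain ⟨hk1, hk2⟩ := hk
  have eu := hu.eqn t y hy
  have ev := hv.eqn (t + s) y hy
  simp only [Ha] at eu ev
  have hdefect := hdef t hqR.1 y hqR.2
  have hpw : y ^ (1 - a - 1) = y * y ^ (1 - a - 1 - 1) := by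
    rw [Real.rpow_sub_one hy.ne' (1 - a - 1), mul_div_cancel₀ _ hy.ne']
  have hk3 : a / y * py v (t + s) y - a / y * py u t y =
      a * c * (1 - a) * y ^ (1 - a - 1 - 1) - 2 * a * c * K := by
    rw [← mul_sub, show py v (t + s) y - py u t y =
      c * ((1 - a) * (y * y ^ (1 - a - 1 - 1)) - K * (2 * y)) by rw [← hpw]; linarith]
    field_simp
  have hN : 0 ≤ (n : ℝ) - 1 := by
    have : (2 : ℝ) ≤ n := by exact_mod_cast hn
    linarith
  have hcKpos : 0 < c * K := mul_pos hcpos hKpos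
  have htanh : Real.tanh t * (t - t₀) ≤ 1 := by
    have h1 : |Real.tanh t * (t - t₀)| ≤ 1 := by
      rw [abs_mul]
      exact mul_le_one₀ (Real.abs_tanh_lt_one t).le (abs_nonneg _) (htr.le.trans hr1)
    exact (abs_le.1 h1).2
  have hdrift : ((n : ℝ) - 1) * (Real.tanh t * (t - t₀)) ≤ n - 1 := by
    simpa using mul_le_mul_of_nonneg_left htanh hN
  have hdrift2 := mul_le_mul_of_nonneg_left hdrift hcKpos.le
  have hpt : ((n : ℝ) - 1) * Real.tanh t * pt v (t + s) y -
      ((n : ℝ) - 1) * Real.tanh t * pt u t y =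
      -(2 * (c * K * (((n : ℝ) - 1) * (Real.tanh t * (t - t₀))))) := by
    rw [← mul_sub, show pt v (t + s) y - pt u t y = c * (-(K * (2 * (t - t₀)))) by linarith]
    ring
  have hacK : c * K * a ≤ c * K * 1 := mul_le_mul_of_nonneg_left ha.2.le hcKpos.le
  linarith

/-- The graph of `v (· + s)` cannot touch that of `u` from above on the trace when `s > 0`. -/
theorem not_touching (hn : 2 ≤ n) (ha : a ∈ Ioo (-1 : ℝ) 1)
    (hu : BRSolution n a F u) (hv : BRSolution n a F v) {s t₀ : ℝ} (hs : 0 < s)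
    (hle : ∀ t y : ℝ, 0 ≤ y → u t y ≤ v (t + s) y) (hpos : 0 < pt v (t₀ + s) 0) :
    u t₀ 0 ≠ v (t₀ + s) 0 := by
  intro heq
  have hN : 0 < (n : ℝ) - 1 := by
    have : (2 : ℝ) ≤ n := by exact_mod_cast hn
    linarith
  set ω : ℝ × ℝ → ℝ := fun p =>
    ((n : ℝ) - 1) * (Real.tanh (p.1 + s) - Real.tanh p.1) * pt v (p.1 + s) p.2 with hω
  have hω0 : 0 < ω (t₀, 0) :=
    mul_pos (mul_pos hN (sub_pos.2 (strictMono_tanh_real (by linarith)))) hpos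
  have htc : Continuous Real.tanh :=
    continuous_iff_continuousAt.2 fun t => (hasDerivAt_tanh_real t).continuousAt
  have hcont : ContinuousOn ω {p : ℝ × ℝ | 0 ≤ p.2} := by
    have h1 : ContinuousOn (fun p : ℝ × ℝ => pt v (p.1 + s) p.2) {p : ℝ × ℝ | 0 ≤ p.2} :=
      hv.pt_cont.comp (f := fun p : ℝ × ℝ => (p.1 + s, p.2)) (by fun_prop) fun _ hp => hp
    have h2 : Continuous fun p : ℝ × ℝ =>
        ((n : ℝ) - 1) * (Real.tanh (p.1 + s) - Real.tanh p.1) := by fun_prop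
    exact h2.continuousOn.mul h1
  have hev := (hcont (t₀, 0) (le_refl (0 : ℝ))).eventually (lt_mem_nhds (half_lt_self hω0))
  obtain ⟨ρ, hρ, hball⟩ := Metric.mem_nhdsWithin_iff.1 hev
  have hr : 0 < min 1 (ρ / 2) := lt_min one_pos (half_pos hρ)
  have hrρ : min 1 (ρ / 2) < ρ := (min_le_right _ _).trans_lt (half_lt_self hρ)
  obtain ⟨c, K, hc, hgrow⟩ := boundary_growth hn ha hu hv hr (min_le_left _ _) (half_pos hω0) hle
    (by
      intro t ht y hy
      refine hball (a := (t, y)) ⟨?_, hy.1⟩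
      rw [Metric.mem_ball, Prod.dist_eq, max_lt_iff, Real.dist_eq, Real.dist_eq]
      constructor
      · exact (abs_le.2 ⟨by linarith [ht.1], by linarith [ht.2]⟩ :
          |t - t₀| ≤ min 1 (ρ / 2)).trans_lt hrρ
      · simp only [sub_zero]
        rw [abs_of_nonneg hy.1]
        exact hy.2.trans_lt hrρ)
  refine weighted_deriv_not_tendsto_zero ha hc hr
    (w := fun y => v (t₀ + s) y - u t₀ y) (w' := fun y => py v (t₀ + s) y - py u t₀ y)
    ((hv.continuousOn_vertical _).sub (hu.continuousOn_vertical _))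
    (fun y hy => (hv.hasDerivAt_py _ hy).sub (hu.hasDerivAt_py _ hy))
    (by simp [heq]) hgrow ?_
  have := (hv.bc (t₀ + s)).sub (hu.bc t₀)
  rw [heq, sub_self] at this
  simpa only [mul_sub] using this

/-- At a nonnegative maximum of `u - v (· + s)` on the trace the reaction terms are ordered. -/
theorem reaction_le_of_trace_max (hn : 2 ≤ n) (ha : a ∈ Ioo (-1 : ℝ) 1)
    (hu : BRSolution n a F u) (hv : BRSolution n a F v)
    (hbu : ∀ t y : ℝ, 0 ≤ y → |u t y| < 1) (hbv : ∀ t y : ℝ, 0 ≤ y → |v t y| < 1)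
    (hmono : Monotone fun t => v t 0) {s t₀ : ℝ} (hs : 0 ≤ s)
    (hm : 0 ≤ u t₀ 0 - v (t₀ + s) 0)
    (hmax : ∀ t, u t 0 - v (t + s) 0 ≤ u t₀ 0 - v (t₀ + s) 0) :
    deriv F (u t₀ 0) ≤ deriv F (v (t₀ + s) 0) := by
  have hcomp : ∀ y, 0 ≤ y → u t₀ y - v (t₀ + s) y ≤ u t₀ 0 - v (t₀ + s) 0 := fun y hy =>
    comparison hn ha hu hv hbu hbv hs hm
      (fun t₁ t₂ h => by
        have h1 : v (t₁ + s) 0 ≤ v t₂ 0 := hmono h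
        linarith [hmax t₁]) le_rfl hy
  refine sub_nonpos.1 (weighted_deriv_limit_nonpos (a := a)
    (w := fun y => u t₀ y - v (t₀ + s) y) (w' := fun y => py u t₀ y - py v (t₀ + s) y)
    ((hu.continuousOn_vertical _).sub (hv.continuousOn_vertical _))
    (fun y hy => (hu.hasDerivAt_py _ hy).sub (hv.hasDerivAt_py _ hy)) hcomp ?_)
  simpa only [mul_sub] using (hu.bc t₀).sub (hv.bc (t₀ + s))

theorem exists_strictMonoOn_of_deriv_pos_at {g : ℝ → ℝ} {x : ℝ} (hg : ContDiff ℝ 1 g)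
    (hx : 0 < deriv g x) : ∃ τ > 0, StrictMonoOn g (Icc (x - τ) (x + τ)) := by
  have hc : Continuous (deriv g) := hg.continuous_deriv le_rfl
  obtain ⟨ρ, hρ, hball⟩ := Metric.mem_nhds_iff.1 (hc.continuousAt.eventually (lt_mem_nhds hx))
  refine ⟨ρ, hρ, strictMonoOn_of_deriv_pos (convex_Icc _ _) hg.continuous.continuousOn ?_⟩
  intro z hz
  rw [interior_Icc, ← Real.ball_eq_Ioo] at hz
  exact hball hz

theorem DoubleWell.exists_strictMonoOn (hF : DoubleWell F) :
    ∃ τ > 0, StrictMonoOn (deriv F) (Icc (-1) (-1 + τ)) ∧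
      StrictMonoOn (deriv F) (Icc (1 - τ) 1) := by
  obtain ⟨hsm, -, -, -, -, -, hm, hp⟩ := hF
  have h1 : ContDiff ℝ 1 (deriv F) := by
    have h2 : ContDiff ℝ (1 + 1) F := hsm.of_le (by norm_cast)
    exact (contDiff_succ_iff_deriv.1 h2).2.2
  rw [iteratedDeriv_succ, iteratedDeriv_one] at hm hp
  obtain ⟨τ₁, hτ₁, hs₁⟩ := exists_strictMonoOn_of_deriv_pos_at h1 hm
  obtain ⟨τ₂, hτ₂, hs₂⟩ := exists_strictMonoOn_of_deriv_pos_at h1 hp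
  exact ⟨min τ₁ τ₂, lt_min hτ₁ hτ₂,
    hs₁.mono (Icc_subset_Icc (by linarith) (by linarith [min_le_left τ₁ τ₂])),
    hs₂.mono (Icc_subset_Icc (by linarith [min_le_right τ₁ τ₂]) (by linarith))⟩

/-- If `u` is not below `v (· + s)` on the trace, then the ordering already fails in a window that
does not depend on `s`. -/
theorem exists_window (hn : 2 ≤ n) (ha : a ∈ Ioo (-1 : ℝ) 1) (hF : DoubleWell F)
    (hu : BRSolution n a F u) (hv : BRSolution n a F v)
    (hbu : ∀ t y : ℝ, 0 ≤ y → |u t y| < 1) (hbv : ∀ t y : ℝ, 0 ≤ y → |v t y| < 1)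
    (hmono : Monotone fun t => v t 0)
    (hup : Tendsto (fun t => u t 0) atTop (𝓝 1)) (hum : Tendsto (fun t => u t 0) atBot (𝓝 (-1)))
    (hvp : Tendsto (fun t => v t 0) atTop (𝓝 1))
    (hvm : Tendsto (fun t => v t 0) atBot (𝓝 (-1))) :
    ∃ A : ℝ, ∀ s, 0 ≤ s → (¬ ∀ t, u t 0 ≤ v (t + s) 0) →
      ∃ t, -A ≤ t ∧ t + s ≤ A ∧ v (t + s) 0 < u t 0 := by
  obtain ⟨τ, hτ, hs₁, hs₂⟩ := hF.exists_strictMonoOn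
  obtain ⟨A₁, hA₁⟩ := eventually_atBot.1
    (hum.eventually (gt_mem_nhds (show (-1 : ℝ) < -1 + τ by linarith)))
  obtain ⟨A₂, hA₂⟩ := eventually_atTop.1
    (hvp.eventually (lt_mem_nhds (show 1 - τ < (1 : ℝ) by linarith)))
  refine ⟨max (-A₁) A₂, fun s hs hnot => ?_⟩
  push Not at hnot
  obtain ⟨t', ht'⟩ := hnot
  set d : ℝ → ℝ := fun t => u t 0 - v (t + s) 0 with hd
  have hdc : Continuous d :=
    hu.continuous_trace.sub (hv.continuous_trace.comp (by fun_prop : Continuous fun t => t + s))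
  have hdp : 0 < d t' := sub_pos.2 ht'
  have hlimt : Tendsto d atTop (𝓝 0) := by
    simpa using hup.sub (hvp.comp (tendsto_atTop_add_const_right _ s tendsto_id))
  have hlimb : Tendsto d atBot (𝓝 0) := by
    simpa using hum.sub (hvm.comp (tendsto_atBot_add_const_right _ s tendsto_id))
  obtain ⟨t, ht⟩ := hdc.exists_forall_ge' t' (by
    rw [cocompact_eq_atBot_atTop, eventually_sup]
    exact ⟨(hlimb.eventually (gt_mem_nhds hdp)).mono fun _ h => h.le,
      (hlimt.eventually (gt_mem_nhds hdp)).mono fun _ h => h.le⟩)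
  have hpos : 0 < u t 0 - v (t + s) 0 := hdp.trans_le (ht t')
  have hreac := reaction_le_of_trace_max hn ha hu hv hbu hbv hmono hs hpos.le ht
  have hu1 := abs_lt.1 (hbu t 0 le_rfl)
  have hv1 := abs_lt.1 (hbv (t + s) 0 le_rfl)
  refine ⟨t, ?_, ?_, by linarith⟩
  · by_contra! hlt
    have h1 := hA₁ t (by linarith [le_max_left (-A₁) A₂])
    have h2 := hs₁ (a := v (t + s) 0) (b := u t 0) ⟨by linarith, by linarith⟩
      ⟨by linarith, by linarith⟩ (by linarith)
    linarith
  · by_contra! hlt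
    have h1 := hA₂ (t + s) (by linarith [le_max_right (-A₁) A₂])
    have h2 := hs₂ (a := v (t + s) 0) (b := u t 0) ⟨by linarith, by linarith⟩
      ⟨by linarith, by linarith⟩ (by linarith)
    linarith

/-- Sliding: layer solutions are ordered. -/
theorem layer_le (hn : 2 ≤ n) (ha : a ∈ Ioo (-1 : ℝ) 1) (hF : DoubleWell F)
    (hu : BRSolution n a F u) (hv : BRSolution n a F v)
    (hbu : ∀ t y : ℝ, 0 ≤ y → |u t y| < 1) (hbv : ∀ t y : ℝ, 0 ≤ y → |v t y| < 1)
    (hpos : ∀ t : ℝ, 0 < pt v t 0)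
    (hup : Tendsto (fun t => u t 0) atTop (𝓝 1)) (hum : Tendsto (fun t => u t 0) atBot (𝓝 (-1)))
    (hvp : Tendsto (fun t => v t 0) atTop (𝓝 1))
    (hvm : Tendsto (fun t => v t 0) atBot (𝓝 (-1)))
    (t y : ℝ) (hy : 0 ≤ y) : u t y ≤ v t y := by
  have hmono : Monotone fun t => v t 0 := (strictMono_of_deriv_pos hpos).monotone
  obtain ⟨A, hA⟩ := exists_window hn ha hF hu hv hbu hbv hmono hup hum hvp hvm
  have hext : ∀ s, 0 ≤ s → (∀ t, u t 0 ≤ v (t + s) 0) → ∀ t y, 0 ≤ y → u t y ≤ v (t + s) y := by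
    intro s hs h t y hy
    refine sub_nonpos.1 (comparison hn ha hu hv hbu hbv hs le_rfl (fun t₁ t₂ h12 => ?_) le_rfl hy)
    exact sub_nonpos.2 ((h t₁).trans (hmono h12))
  set S : Set ℝ := {s | 0 ≤ s ∧ ∀ t, u t 0 ≤ v (t + s) 0} with hS
  have hSne : S.Nonempty := by
    refine ⟨2 * |A| + 1, by positivity, ?_⟩
    by_contra h
    obtain ⟨t, h1, h2, -⟩ := hA _ (by positivity) h
    linarith [le_abs_self A]
  have hSbdd : BddBelow S := ⟨0, fun s hs => hs.1⟩
  have hSclosed : IsClosed S := by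
    have : S = Ici 0 ∩ ⋂ t, {s | u t 0 ≤ v (t + s) 0} := by
      ext s; simp [hS]
    rw [this]
    exact isClosed_Ici.inter (isClosed_iInter fun t => isClosed_le continuous_const
      (hv.continuous_trace.comp (by fun_prop : Continuous fun s => t + s)))
  have hmem : sInf S ∈ S := hSclosed.csInf_mem hSne hSbdd
  set σ : ℝ := sInf S with hσ
  have hσ0 : σ = 0 := by
    by_contra hne
    have hσpos : 0 < σ := lt_of_le_of_ne hmem.1 (Ne.symm hne)
    set C : Set (ℝ × ℝ) := (Icc (-A) A ×ˢ Icc 0 σ) ∩ {p | v (p.1 + p.2) 0 ≤ u p.1 0} with hC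
    have hCc : IsCompact C := (isCompact_Icc.prod isCompact_Icc).inter_right
      (isClosed_le (hv.continuous_trace.comp (by fun_prop : Continuous fun p : ℝ × ℝ => p.1 + p.2))
        (hu.continuous_trace.comp continuous_fst))
    have hsub : Ico 0 σ ⊆ Prod.snd '' C := by
      intro s hs
      have hns : ¬ ∀ t, u t 0 ≤ v (t + s) 0 := fun h =>
        (not_le.2 hs.2) (csInf_le hSbdd ⟨hs.1, h⟩)
      obtain ⟨t, h1, h2, h3⟩ := hA s hs.1 hns
      exact ⟨(t, s), ⟨⟨⟨h1, by linarith [hs.1]⟩, hs.1, hs.2.le⟩, h3.le⟩, rfl⟩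
    have hcl : σ ∈ Prod.snd '' C := by
      have h1 := closure_minimal hsub (hCc.image continuous_snd).isClosed
      rw [closure_Ico hσpos.ne] at h1
      exact h1 (right_mem_Icc.2 hσpos.le)
    obtain ⟨⟨t, s⟩, ⟨-, hts⟩, rfl⟩ := hcl
    exact not_touching hn ha hu hv hσpos (hext _ hmem.1 hmem.2) (hpos _)
      (le_antisymm (hmem.2 t) hts)
  have := hext σ hmem.1 hmem.2 t y hy
  rwa [hσ0, add_zero] at this

end Sliding

/-- Uniqueness of the layer solution: two classical solutions of the boundary reaction
problem with `|uᵢ| < 1`, `∂_t uᵢ(·,0) > 0`, limits `±1` at `±∞`, and `uᵢ(0,0) = 0`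
coincide on `ℝ × [0,∞)`. -/
theorem stmt1 (n : ℕ) (hn : 2 ≤ n) (a : ℝ) (ha : a ∈ Set.Ioo (-1:ℝ) 1)
    (F : ℝ → ℝ) (hF : DoubleWell F) (u₁ u₂ : ℝ → ℝ → ℝ)
    (hu₁ : BRSolution n a F u₁) (hu₂ : BRSolution n a F u₂)
    (hb₁ : ∀ t y : ℝ, 0 ≤ y → |u₁ t y| < 1) (hb₂ : ∀ t y : ℝ, 0 ≤ y → |u₂ t y| < 1)
    (hm₁ : ∀ t : ℝ, 0 < pt u₁ t 0) (hm₂ : ∀ t : ℝ, 0 < pt u₂ t 0)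
    (hl₁p : Tendsto (fun t => u₁ t 0) atTop (𝓝 1))
    (hl₁m : Tendsto (fun t => u₁ t 0) atBot (𝓝 (-1)))
    (hl₂p : Tendsto (fun t => u₂ t 0) atTop (𝓝 1))
    (hl₂m : Tendsto (fun t => u₂ t 0) atBot (𝓝 (-1)))
    (h0₁ : u₁ 0 0 = 0) (h0₂ : u₂ 0 0 = 0) :
    ∀ t y : ℝ, 0 ≤ y → u₁ t y = u₂ t y := by
  intro t y hy
  exact le_antisymm
    (layer_le hn ha hF hu₁ hu₂ hb₁ hb₂ hm₂ hl₁p hl₁m hl₂p hl₂m t y hy)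
    (layer_le hn ha hF hu₂ hu₁ hb₂ hb₁ hm₁ hl₂p hl₂m hl₁p hl₁m t y hy)
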